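/- arXiv:1603.04285 — 3 statements merged into one kernel-verified Lean document; each statement's English description precedes it below -/
import Mathlib

section
/- Let (F,σ) be a difference field of characteristic 0. Let H := F[z_1,…,z_l]/⟨z_1^{λ_1}−1,…,z_l^{λ_l}−1⟩ with y_i the image of z_i, where each λ_i > 1 and σ is extended to a ring automorphism of H by σ(y_i) = α_i·y_i for some α_i ∈ const(F,σ) with α_i^{λ_i} = 1. Let L := H[p_1^{±1},…,p_r^{±1}] be the Laurent polynomial ring in r variables over H, with σ extended by σ(p_j) = a_j·p_j for some nonzero a_j ∈ F. Let E := L[s_1,…,s_v] be the polynomial ring in v variables over L, with σ extended by σ(s_k) = s_k + β_k where β_k lies in the L-subalgebra L[s_1,…,s_{k−1}] generated by the earlier variables. If const(E,σ) = const(F,σ) (every f ∈ E with σ(f) = f lies in the image of const(F,σ)), then (E,σ) is a simple difference ring: every ideal I of E with σ(I) ⊆ I equals {0} or E. -/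
open scoped MonomialOrder in
/-- A ring endomorphism of a polynomial ring which is unitriangular with respect to a monomial
order acts coefficientwise on all monomials at or above the degree of a polynomial. -/
theorem MonomialOrder.coeff_map_of_degree_le {ι R : Type*} [CommRing R] (m : MonomialOrder ι)
    (τ : R →+* R) (φ : MvPolynomial ι R →+* MvPolynomial ι R)
    (hC : ∀ x, φ (MvPolynomial.C x) = MvPolynomial.C (τ x))
    (hX : ∀ i, m.degree (φ (MvPolynomial.X i)) ≼[m] Finsupp.single i 1 ∧
      (φ (MvPolynomial.X i)).coeff (Finsupp.single i 1) = 1)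
    (f : MvPolynomial ι R) (e : ι →₀ ℕ) (he : m.degree f ≼[m] e) :
    (φ f).coeff e = τ (f.coeff e) := by
  have mul {d d' : ι →₀ ℕ} {p q : MvPolynomial ι R}
      (hp : m.degree p ≼[m] d ∧ p.coeff d = 1) (hq : m.degree q ≼[m] d' ∧ q.coeff d' = 1) :
      m.degree (p * q) ≼[m] d + d' ∧ (p * q).coeff (d + d') = 1 := by
    refine ⟨m.degree_mul_le.trans ?_, ?_⟩
    · simpa only [map_add] using add_le_add hp.1 hq.1
    · rw [m.coeff_mul_of_add_of_degree_le hp.1 hq.1, hp.2, hq.2, one_mul]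
  have one : m.degree (1 : MvPolynomial ι R) ≼[m] 0 ∧ (1 : MvPolynomial ι R).coeff 0 = 1 := by
    simp
  have mono (d : ι →₀ ℕ) : m.degree (φ (MvPolynomial.monomial d 1)) ≼[m] d ∧
      (φ (MvPolynomial.monomial d 1)).coeff d = 1 := by
    induction d using Finsupp.induction_linear with
    | zero => simp
    | add d d' hd hd' =>
      have h := mul hd hd'
      rwa [← map_mul, MvPolynomial.monomial_mul, one_mul] at h
    | single i n =>
      induction n with
      | zero => simp
      | succ n ih =>
        have h := mul ih (hX i)
        rwa [← map_mul, MvPolynomial.X, MvPolynomial.monomial_mul, one_mul,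
          ← Finsupp.single_add] at h
  have hsum : φ f = ∑ d ∈ f.support,
      MvPolynomial.C (τ (f.coeff d)) * φ (MvPolynomial.monomial d 1) := by
    conv_lhs => rw [f.as_sum, map_sum]
    refine Finset.sum_congr rfl fun d _ ↦ ?_
    rw [← hC, ← map_mul, MvPolynomial.C_mul_monomial, mul_one]
  rw [hsum, MvPolynomial.coeff_sum, Finset.sum_eq_single e]
  · rw [MvPolynomial.coeff_C_mul, (mono e).2, mul_one]
  · intro d hd hde
    have hlt : d ≺[m] e := lt_of_le_of_ne ((m.le_degree hd).trans he)
      fun h ↦ hde (m.toSyn.injective h)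
    rw [MvPolynomial.coeff_C_mul, m.coeff_eq_zero_of_lt ((mono d).1.trans_lt hlt), mul_zero]
  · intro h
    rw [MvPolynomial.notMem_support_iff.mp h]
    simp

open scoped MonomialOrder in
/-- If the coefficient ring is difference simple, a nonzero difference ideal of a tower of
sum-extensions contains a nonzero constant. -/
theorem MvPolynomial.exists_ne_zero_mem_map_eq_self {ι R : Type*} [LinearOrder ι] [Finite ι]
    [CommRing R] (τ : R →+* R)
    (hτ : ∀ J : Ideal R, (∀ x ∈ J, τ x ∈ J) → J = ⊥ ∨ J = ⊤)
    (β : ι → MvPolynomial ι R) (hβ : ∀ k, β k ∈ MvPolynomial.supported R {j | j < k})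
    (φ : MvPolynomial ι R →+* MvPolynomial ι R)
    (hC : ∀ x, φ (MvPolynomial.C x) = MvPolynomial.C (τ x))
    (hX : ∀ k, φ (MvPolynomial.X k) = MvPolynomial.X k + β k)
    (I : Ideal (MvPolynomial ι R)) (hI : ∀ x ∈ I, φ x ∈ I) (hbot : I ≠ ⊥) :
    ∃ g ∈ I, g ≠ 0 ∧ φ g = g := by
  let m : MonomialOrder ι := MonomialOrder.lex (σ := ιᵒᵈ)
  have hβlt (k : ι) (d : ι →₀ ℕ) (hd : d ∈ (β k).support) : d ≺[m] Finsupp.single k 1 := by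
    have hd0 (j : ι) (hj : k ≤ j) : d j = 0 := by
      by_contra hne
      have hmem := MvPolynomial.mem_supported.mp (hβ k)
        (MvPolynomial.mem_vars_iff_mem_support j |>.mpr ⟨d, hd, Finsupp.mem_support_iff.mpr hne⟩)
      exact (lt_of_lt_of_le hmem hj).false
    refine (MonomialOrder.lex_lt_iff (σ := ιᵒᵈ)).mpr (Finsupp.Lex.lt_iff.mpr
      ⟨k, fun (j : ι) (hj : k < j) ↦ ?_, ?_⟩)
    · change d j = Finsupp.single k 1 j
      simp [hd0 j hj.le, hj.ne']
    · change d k < Finsupp.single k 1 k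
      simp [hd0 k le_rfl]
  have key := m.coeff_map_of_degree_le τ φ hC (fun k ↦ by
    rw [hX]
    have h0 : (β k).coeff (Finsupp.single k 1) = 0 := by
      by_contra hne
      exact (hβlt k _ (MvPolynomial.mem_support_iff.mpr hne)).false
    refine ⟨m.degree_le_iff.mpr fun c hc ↦ ?_, by simp [h0]⟩
    by_cases hck : c = Finsupp.single k 1
    · rw [hck]
    · refine (hβlt k c (MvPolynomial.mem_support_iff.mpr fun h ↦ ?_)).le
      rw [MvPolynomial.mem_support_iff, MvPolynomial.coeff_add, h, MvPolynomial.coeff_X,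
        if_neg (Ne.symm hck), add_zero] at hc
      exact hc rfl)
  obtain ⟨f₀, hf₀I, hf₀⟩ := Submodule.exists_mem_ne_zero_of_ne_bot hbot
  obtain ⟨f, ⟨hfI, hf⟩, hmin⟩ := (InvImage.wf (fun g : MvPolynomial ι R ↦ m.toSyn (m.degree g))
    wellFounded_lt).has_min {g | g ∈ I ∧ g ≠ 0} ⟨f₀, hf₀I, hf₀⟩
  let J : Ideal R :=
    { carrier := {c | ∃ g ∈ I, m.degree g ≼[m] m.degree f ∧ g.coeff (m.degree f) = c}
      add_mem' := by
        rintro _ _ ⟨g, hg, hgd, rfl⟩ ⟨g', hg', hgd', rfl⟩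
        exact ⟨g + g', I.add_mem hg hg', m.degree_add_le.trans (max_le hgd hgd'),
          MvPolynomial.coeff_add _ _ _⟩
      zero_mem' := ⟨0, I.zero_mem, by simp, by simp⟩
      smul_mem' := by
        rintro c _ ⟨g, hg, hgd, rfl⟩
        refine ⟨MvPolynomial.C c * g, I.mul_mem_left _ hg, ?_, MvPolynomial.coeff_C_mul _ _ _⟩
        refine m.degree_mul_le.trans ?_
        simpa using hgd }
  have hJ : ∀ x ∈ J, τ x ∈ J := by
    rintro _ ⟨g, hg, hgd, rfl⟩
    refine ⟨φ g, hI g hg, m.degree_le_iff.mpr fun e he ↦ ?_, key g _ hgd⟩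
    by_contra! hlt
    rw [MvPolynomial.mem_support_iff, key g e (hgd.trans hlt.le),
      m.coeff_eq_zero_of_lt (hgd.trans_lt hlt), map_zero] at he
    exact he rfl
  have hfJ : m.leadingCoeff f ∈ J := ⟨f, hfI, le_rfl, rfl⟩
  have hne : m.leadingCoeff f ≠ 0 := m.leadingCoeff_ne_zero_iff.mpr hf
  have htop : J = ⊤ := (hτ J hJ).resolve_left fun h ↦ hne (by rwa [h, Ideal.mem_bot] at hfJ)
  obtain ⟨g, hg, hgd, hg1⟩ : (1 : R) ∈ J := htop ▸ Submodule.mem_top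
  refine ⟨g, hg, ?_, ?_⟩
  · rintro rfl
    have : Subsingleton R := subsingleton_of_zero_eq_one (by simpa using hg1)
    exact hne (Subsingleton.elim _ _)
  · by_contra hφ
    have hsub : φ g - g ≠ 0 := sub_ne_zero.mpr hφ
    refine hmin _ ⟨I.sub_mem (hI g hg) hg, hsub⟩ (lt_of_not_ge fun hle ↦ ?_)
    refine hsub (m.leadingCoeff_eq_zero_iff.mp ?_)
    rw [MonomialOrder.leadingCoeff, MvPolynomial.coeff_sub, key g _ (hgd.trans hle)]
    rcases hle.eq_or_lt with h | h
    · rw [← m.toSyn.injective h, hg1, map_one, sub_self]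
    · rw [m.coeff_eq_zero_of_lt (hgd.trans_lt h), map_zero, sub_self]

/-- The units that a ring endomorphism `τ` of an `F`-algebra multiplies by a scalar. -/
def semiInvariantUnits (F : Type*) {A : Type*} [Field F] [CommRing A] [Algebra F A]
    (τ : A →+* A) : Submonoid A where
  carrier := {x | IsUnit x ∧ ∃ c : F, τ x = c • x}
  one_mem' := ⟨isUnit_one, 1, by simp⟩
  mul_mem' := by
    rintro x y ⟨hx, c, hc⟩ ⟨hy, d, hd⟩
    exact ⟨hx.mul hy, c * d, by rw [map_mul, hc, hd, smul_mul_smul_comm]⟩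

theorem mem_semiInvariantUnits_of_mul_eq_one {F A : Type*} [Field F] [CommRing A] [Algebra F A]
    {τ : A →+* A} {x y : A} (hx : x ∈ semiInvariantUnits F τ) (hxy : x * y = 1) :
    y ∈ semiInvariantUnits F τ := by
  obtain ⟨hxu, c, hc⟩ := hx
  refine ⟨IsUnit.of_mul_eq_one x (by rw [mul_comm, hxy]), c⁻¹, ?_⟩
  have h1 : c • (x * τ y) = 1 := by rw [← smul_mul_assoc, ← hc, ← map_mul, hxy, map_one]
  rcases eq_or_ne c 0 with rfl | hc0
  · have : Subsingleton A := subsingleton_of_zero_eq_one (by simpa using h1)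
    exact Subsingleton.elim _ _
  · refine hxu.mul_left_cancel ?_
    rw [mul_smul_comm, hxy, eq_inv_smul_iff₀ hc0, h1]

/-- If an algebra is spanned by semi-invariant units, every nonzero difference ideal contains a
nonzero constant. -/
theorem exists_ne_zero_mem_map_eq_self_of_span_semiInvariantUnits {F A : Type*} [Field F]
    [CommRing A] [Algebra F A] (σ : F →+* F) (τ : A →+* A)
    (hτ : ∀ c, τ (algebraMap F A c) = algebraMap F A (σ c))
    (hspan : Submodule.span F (semiInvariantUnits F τ : Set A) = ⊤)
    (I : Ideal A) (hI : ∀ x ∈ I, τ x ∈ I) (hbot : I ≠ ⊥) :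
    ∃ g ∈ I, g ≠ 0 ∧ τ g = g := by
  classical
  have hsmul (c : F) (x : A) : τ (c • x) = σ c • τ x := by
    rw [Algebra.smul_def, map_mul, hτ, ← Algebra.smul_def]
  have hex : ∃ S : Finset A, (S : Set A) ⊆ semiInvariantUnits F τ ∧
      ∃ c : A → F, ∑ x ∈ S, c x • x ∈ I ∧ ∑ x ∈ S, c x • x ≠ 0 := by
    obtain ⟨f, hfI, hf⟩ := Submodule.exists_mem_ne_zero_of_ne_bot hbot
    have hfs : f ∈ Submodule.span F (semiInvariantUnits F τ : Set A) := hspan ▸ Submodule.mem_top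
    obtain ⟨c, S, hS, -, rfl⟩ := Submodule.mem_span_iff_exists_finset_subset.mp hfs
    exact ⟨S, hS, c, hfI, hf⟩
  obtain ⟨S, ⟨hS, c, hcI, hc⟩, hmin⟩ := (InvImage.wf (fun S : Finset A ↦ S.card)
    wellFounded_lt).has_min {S : Finset A | (S : Set A) ⊆ semiInvariantUnits F τ ∧
      ∃ c : A → F, ∑ x ∈ S, c x • x ∈ I ∧ ∑ x ∈ S, c x • x ≠ 0} hex
  obtain ⟨u, hu⟩ : S.Nonempty := Finset.nonempty_iff_ne_empty.mpr fun h ↦ hc (by simp [h])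
  have herase (d : A → F) (hd : d u = 0) (hdI : ∑ x ∈ S, d x • x ∈ I) :
      ∑ x ∈ S, d x • x = 0 := by
    by_contra hne
    rw [← Finset.add_sum_erase S _ hu, hd, zero_smul, zero_add] at hdI hne
    exact hmin (S.erase u) ⟨(Finset.coe_subset.mpr (S.erase_subset u)).trans hS, d, hdI, hne⟩
      (Finset.card_erase_lt_of_mem hu)
  have hcu : c u ≠ 0 := fun h ↦ hc (herase c h hcI)
  choose! χ hχ using fun x (hx : x ∈ S) ↦ (hS hx).2
  obtain ⟨w, huw⟩ := (hS hu).1.exists_right_inv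
  obtain ⟨hwu, ω, hω⟩ := mem_semiInvariantUnits_of_mul_eq_one (hS hu) huw
  set f : A := ∑ x ∈ S, ((c u)⁻¹ * c x) • x with hfdef
  have hfeq : f = (c u)⁻¹ • ∑ x ∈ S, c x • x := by
    simp only [hfdef, Finset.smul_sum, mul_smul]
  have hfI : f ∈ I := hfeq ▸ Submodule.smul_of_tower_mem I _ hcI
  have hf0 : f ≠ 0 := hfeq ▸ smul_ne_zero (inv_ne_zero hcu) hc
  have hsub : τ f - χ u • f =
      ∑ x ∈ S, (σ ((c u)⁻¹ * c x) * χ x - χ u * ((c u)⁻¹ * c x)) • x := by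
    rw [hfdef, map_sum, Finset.smul_sum, ← Finset.sum_sub_distrib]
    refine Finset.sum_congr rfl fun x hx ↦ ?_
    rw [hsmul, hχ x hx, sub_smul, smul_smul, smul_smul]
  have hτf : τ f = χ u • f := by
    rw [← sub_eq_zero, hsub]
    refine herase _ (by simp [inv_mul_cancel₀ hcu]) ?_
    rw [← hsub]
    exact I.sub_mem (hI f hfI) (Submodule.smul_of_tower_mem I _ hfI)
  refine ⟨w * f, I.mul_mem_left _ hfI, fun h ↦ hf0 (hwu.mul_right_eq_zero.mp h), ?_⟩
  have h1 : (χ u * ω) • (1 : A) = 1 := by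
    rw [← huw, ← smul_mul_smul_comm, ← hχ u hu, ← hω, ← map_mul, huw, map_one]
  calc τ (w * f) = ((χ u * ω) • (1 : A)) * (w * f) := by
        rw [map_mul, hω, hτf, smul_mul_smul_comm, smul_mul_assoc, one_mul, mul_comm ω]
    _ = w * f := by rw [h1, one_mul]

/-- A Laurent polynomial ring whose coefficient algebra is generated by semi-invariant units and
whose variables are semi-invariant is spanned by semi-invariant units. -/
theorem span_semiInvariantUnits_laurent {F H ι κ : Type*} [Field F] [CommRing H] [Algebra F H]
    (τ : AddMonoidAlgebra H (ι →₀ ℤ) →+* AddMonoidAlgebra H (ι →₀ ℤ))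
    (y : κ → H) (hgen : Algebra.adjoin F (Set.range y) = ⊤)
    (hy : ∀ i, IsUnit (y i)) (α : κ → F)
    (hτy : ∀ i, τ (AddMonoidAlgebra.single 0 (y i)) =
      AddMonoidAlgebra.single 0 (algebraMap F H (α i) * y i))
    (a : ι → F)
    (hτp : ∀ j, τ (AddMonoidAlgebra.single (Finsupp.single j 1) 1) =
      AddMonoidAlgebra.single 0 (algebraMap F H (a j)) *
        AddMonoidAlgebra.single (Finsupp.single j 1) 1) :
    Submodule.span F (semiInvariantUnits F τ : Set (AddMonoidAlgebra H (ι →₀ ℤ))) = ⊤ := by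
  set M := semiInvariantUnits F τ
  have hyM (i : κ) : AddMonoidAlgebra.single 0 (y i) ∈ M := by
    refine ⟨(hy i).map (AddMonoidAlgebra.singleZeroRingHom (M := ι →₀ ℤ)), α i, ?_⟩
    rw [hτy, AddMonoidAlgebra.smul_single, Algebra.smul_def]
  have hcancel (j : ι) (k : ℤ) : AddMonoidAlgebra.single (Finsupp.single j k) (1 : H) *
      AddMonoidAlgebra.single (Finsupp.single j (-k)) 1 = 1 := by
    rw [AddMonoidAlgebra.single_mul_single, ← Finsupp.single_add]
    simp [AddMonoidAlgebra.one_def]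
  have hpM (j : ι) : AddMonoidAlgebra.single (Finsupp.single j 1) 1 ∈ M := by
    refine ⟨IsUnit.of_mul_eq_one _ (hcancel j 1), a j, ?_⟩
    rw [hτp, AddMonoidAlgebra.single_mul_single, AddMonoidAlgebra.smul_single, Algebra.smul_def,
      zero_add]
  have hadd {n n' : ι →₀ ℤ} (h : AddMonoidAlgebra.single n 1 ∈ M)
      (h' : AddMonoidAlgebra.single n' 1 ∈ M) : AddMonoidAlgebra.single (n + n') 1 ∈ M := by
    have := M.mul_mem h h'
    rwa [AddMonoidAlgebra.single_mul_single, one_mul] at this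
  have hnat (j : ι) (k : ℕ) : AddMonoidAlgebra.single (Finsupp.single j (k : ℤ)) 1 ∈ M := by
    induction k with
    | zero =>
      rw [Nat.cast_zero, Finsupp.single_zero]
      exact M.one_mem
    | succ k ih =>
      rw [Nat.cast_succ, Finsupp.single_add]
      exact hadd ih (hpM j)
  have hmono (n : ι →₀ ℤ) : AddMonoidAlgebra.single n 1 ∈ M := by
    induction n using Finsupp.induction_linear with
    | zero => exact M.one_mem
    | add n n' h h' => exact hadd h h'
    | single j k =>
      obtain ⟨k, rfl | rfl⟩ := k.eq_nat_or_neg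
      · exact hnat j k
      · exact mem_semiInvariantUnits_of_mul_eq_one (hnat j k) (hcancel j k)
  have hadj := Algebra.adjoin_eq_span F (M : Set (AddMonoidAlgebra H (ι →₀ ℤ)))
  rw [Submonoid.closure_eq] at hadj
  rw [← hadj, Algebra.toSubmodule_eq_top, eq_top_iff]
  have hcoeff (h : H) : AddMonoidAlgebra.single 0 h ∈
      Algebra.adjoin F (M : Set (AddMonoidAlgebra H (ι →₀ ℤ))) := by
    have hh : h ∈ Algebra.adjoin F (Set.range y) := hgen ▸ Algebra.mem_top
    induction hh using Algebra.adjoin_induction with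
    | mem x hx =>
      obtain ⟨i, rfl⟩ := hx
      exact Algebra.subset_adjoin (hyM i)
    | algebraMap c => exact Subalgebra.algebraMap_mem _ c
    | add x y _ _ hx hy =>
      rw [AddMonoidAlgebra.single_add]
      exact add_mem hx hy
    | mul x y _ _ hx hy =>
      have := mul_mem hx hy
      rwa [AddMonoidAlgebra.single_mul_single, zero_add] at this
  rintro x -
  induction x using AddMonoidAlgebra.induction_linear with
  | zero => exact zero_mem _
  | add x y hx hy => exact add_mem hx hy
  | single n h =>
    have := mul_mem (hcoeff h) (Algebra.subset_adjoin (hmono n))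
    rwa [AddMonoidAlgebra.single_mul_single, zero_add, mul_one] at this

/-- A tower of sum-extensions, over a difference algebra spanned by semi-invariant units, that has
no constants outside the ground field is difference simple. -/
theorem MvPolynomial.eq_bot_or_eq_top_of_span_semiInvariantUnits {F L ι : Type*} [Field F]
    [CommRing L] [Algebra F L] [LinearOrder ι] [Finite ι] (σ : F →+* F) (τ : L →+* L)
    (hτ : ∀ c, τ (algebraMap F L c) = algebraMap F L (σ c))
    (hspan : Submodule.span F (semiInvariantUnits F τ : Set L) = ⊤)
    (β : ι → MvPolynomial ι L)
    (hβ : ∀ k, β k ∈ Algebra.adjoin L {x | ∃ j, j < k ∧ x = MvPolynomial.X j})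
    (φ : MvPolynomial ι L →+* MvPolynomial ι L)
    (hC : ∀ x, φ (MvPolynomial.C x) = MvPolynomial.C (τ x))
    (hX : ∀ k, φ (MvPolynomial.X k) = MvPolynomial.X k + β k)
    (hconst : ∀ f, φ f = f → ∃ c : F, f = MvPolynomial.C (algebraMap F L c))
    (I : Ideal (MvPolynomial ι L)) (hI : ∀ x ∈ I, φ x ∈ I) : I = ⊥ ∨ I = ⊤ := by
  have hunit {c : F} (hc : algebraMap F L c ≠ 0) : IsUnit (algebraMap F L c) :=
    (IsUnit.mk0 c fun h ↦ hc (by rw [h, map_zero])).map (algebraMap F L)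
  have hL (J : Ideal L) (hJ : ∀ x ∈ J, τ x ∈ J) : J = ⊥ ∨ J = ⊤ := by
    refine or_iff_not_imp_left.mpr fun hbot ↦ ?_
    obtain ⟨g, hg, hg0, hgτ⟩ := exists_ne_zero_mem_map_eq_self_of_span_semiInvariantUnits
      σ τ hτ hspan J hJ hbot
    obtain ⟨c, hc⟩ := hconst (MvPolynomial.C g) (by rw [hC, hgτ])
    obtain rfl := MvPolynomial.C_injective _ _ hc
    exact J.eq_top_of_isUnit_mem hg (hunit hg0)
  refine or_iff_not_imp_left.mpr fun hbot ↦ ?_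
  obtain ⟨g, hg, hg0, hgφ⟩ := MvPolynomial.exists_ne_zero_mem_map_eq_self τ hL β (fun k ↦ by
    rw [MvPolynomial.supported_eq_adjoin_X]
    refine Algebra.adjoin_mono ?_ (hβ k)
    rintro _ ⟨j, hj, rfl⟩
    exact ⟨j, hj, rfl⟩) φ hC hX I hI hbot
  obtain ⟨c, rfl⟩ := hconst g hgφ
  refine I.eq_top_of_isUnit_mem hg ((hunit fun h ↦ hg0 ?_).map MvPolynomial.C)
  rw [h, map_zero]

/-- Let `(F,σ)` be a difference field of characteristic 0,
`H = F[z_1,…,z_l]/⟨z_i^{λ_i}−1⟩` with `σ(y_i) = α_i·y_i` for constants `α_i` with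
`α_i^{λ_i} = 1`, `L = H[p_1^{±1},…,p_r^{±1}]` (a Laurent polynomial ring) with
`σ(p_j) = a_j·p_j` for nonzero `a_j ∈ F`, and `E = L[s_1,…,s_v]` with
`σ(s_k) = s_k + β_k`, `β_k` in the `L`-subalgebra generated by the earlier variables.
If `const(E,σ) = const(F,σ)` then `(E,σ)` is a simple difference ring. -/
theorem stmt8 {F : Type*} [Field F] [CharZero F]
    (σ : F ≃+* F)
    (l r v : ℕ)
    (lam : Fin l → ℕ) (hlam : ∀ i, 1 < lam i)
    (α : Fin l → F) (hαconst : ∀ i, σ (α i) = α i) (hαpow : ∀ i, α i ^ lam i = 1)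
    (IH : Ideal (MvPolynomial (Fin l) F))
    (hIH : IH = Ideal.span (Set.range fun i =>
        MvPolynomial.X i ^ lam i - (1 : MvPolynomial (Fin l) F)))
    (σH : (MvPolynomial (Fin l) F ⧸ IH) ≃+* (MvPolynomial (Fin l) F ⧸ IH))
    (hHC : ∀ c : F, σH (Ideal.Quotient.mk IH (MvPolynomial.C c)) =
        Ideal.Quotient.mk IH (MvPolynomial.C (σ c)))
    (hHX : ∀ i, σH (Ideal.Quotient.mk IH (MvPolynomial.X i)) =
        Ideal.Quotient.mk IH (MvPolynomial.C (α i) * MvPolynomial.X i))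
    (a : Fin r → F) (ha : ∀ j, a j ≠ 0)
    (σL : AddMonoidAlgebra (MvPolynomial (Fin l) F ⧸ IH) (Fin r →₀ ℤ) ≃+*
        AddMonoidAlgebra (MvPolynomial (Fin l) F ⧸ IH) (Fin r →₀ ℤ))
    (hLC : ∀ h : MvPolynomial (Fin l) F ⧸ IH,
        σL (AddMonoidAlgebra.single 0 h) = AddMonoidAlgebra.single 0 (σH h))
    (hLp : ∀ j : Fin r,
        σL (AddMonoidAlgebra.single (Finsupp.single j 1) 1) =
          AddMonoidAlgebra.single 0
              (Ideal.Quotient.mk IH (MvPolynomial.C (a j))) *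
            AddMonoidAlgebra.single (Finsupp.single j 1) 1)
    (β : Fin v → MvPolynomial (Fin v)
        (AddMonoidAlgebra (MvPolynomial (Fin l) F ⧸ IH) (Fin r →₀ ℤ)))
    (hβ : ∀ k, β k ∈ Algebra.adjoin
        (AddMonoidAlgebra (MvPolynomial (Fin l) F ⧸ IH) (Fin r →₀ ℤ))
        {x | ∃ j, j < k ∧ x = (MvPolynomial.X j : MvPolynomial (Fin v)
          (AddMonoidAlgebra (MvPolynomial (Fin l) F ⧸ IH) (Fin r →₀ ℤ)))})
    (σE : MvPolynomial (Fin v)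
        (AddMonoidAlgebra (MvPolynomial (Fin l) F ⧸ IH) (Fin r →₀ ℤ)) ≃+*
        MvPolynomial (Fin v)
        (AddMonoidAlgebra (MvPolynomial (Fin l) F ⧸ IH) (Fin r →₀ ℤ)))
    (hEC : ∀ x, σE (MvPolynomial.C x) = MvPolynomial.C (σL x))
    (hEX : ∀ k, σE (MvPolynomial.X k) = MvPolynomial.X k + β k)
    (hconst : ∀ f, σE f = f → ∃ c : F, σ c = c ∧
        f = MvPolynomial.C (AddMonoidAlgebra.single 0
          (Ideal.Quotient.mk IH (MvPolynomial.C c)))) :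
    ∀ I : Ideal (MvPolynomial (Fin v)
        (AddMonoidAlgebra (MvPolynomial (Fin l) F ⧸ IH) (Fin r →₀ ℤ))),
      (∀ x ∈ I, σE x ∈ I) → I = ⊥ ∨ I = ⊤ := by
  have hgen : Algebra.adjoin F (Set.range fun i ↦
      Ideal.Quotient.mk IH (MvPolynomial.X i : MvPolynomial (Fin l) F)) = ⊤ := by
    have h := congrArg (Subalgebra.map (Ideal.Quotient.mkₐ F IH))
      (MvPolynomial.adjoin_range_X (R := F) (σ := Fin l))
    rwa [AlgHom.map_adjoin, ← Set.range_comp, Algebra.map_top,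
      (AlgHom.range_eq_top _).mpr (Ideal.Quotient.mkₐ_surjective F IH)] at h
  have hunit (i : Fin l) :
      IsUnit (Ideal.Quotient.mk IH (MvPolynomial.X i : MvPolynomial (Fin l) F)) := by
    refine IsUnit.of_pow_eq_one (n := lam i) ?_ (by have := hlam i; omega)
    rw [← map_pow, ← map_one (Ideal.Quotient.mk IH), Ideal.Quotient.eq, hIH]
    exact Ideal.mem_span_range_self
  have hτy (i : Fin l) :
      σL.toRingHom (AddMonoidAlgebra.single 0 (Ideal.Quotient.mk IH (MvPolynomial.X i))) =
        AddMonoidAlgebra.single 0 (algebraMap F _ (α i) *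
          Ideal.Quotient.mk IH (MvPolynomial.X i)) :=
    (hLC _).trans (congrArg (AddMonoidAlgebra.single 0) ((hHX i).trans (map_mul _ _ _)))
  have hspan := span_semiInvariantUnits_laurent σL.toRingHom _ hgen hunit α hτy a hLp
  have hscalar (c : F) : σL.toRingHom (algebraMap F _ c) = algebraMap F _ (σ.toRingHom c) :=
    (hLC _).trans (congrArg (AddMonoidAlgebra.single 0) (hHC c))
  intro I hI
  refine MvPolynomial.eq_bot_or_eq_top_of_span_semiInvariantUnits (ι := Fin v)
    (L := AddMonoidAlgebra (MvPolynomial (Fin l) F ⧸ IH) (Fin r →₀ ℤ)) σ.toRingHom σL.toRingHom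
    ?_ ?_ β ?_ σE.toRingHom ?_ ?_ ?_ I ?_
  · exact hscalar
  · exact hspan
  · exact hβ
  · exact hEC
  · exact hEX
  · exact fun f hf ↦ (hconst f hf).imp fun _ h ↦ h.2
  · exact hI
end

section
/- Let (A,σ) be a difference ring whose ring of constants K := const(A,σ) is a field. Let E := A[t_1,…,t_e] be the polynomial ring in e variables over A, equipped with a ring automorphism σ extending that of A (acting on coefficients) such that σ(t_i) = t_i + β_i where β_i lies in the A-subalgebra A[t_1,…,t_{i−1}] generated by the earlier variables, for each 1 ≤ i ≤ e. Then there exist: a natural number r ≤ e; indices 1 ≤ i_1 < ⋯ < i_{e−r} ≤ e and elements g_j ∈ A[t_1,…,t_{i_j−1}] for 1 ≤ j ≤ e−r such that the ideal I := ⟨t_{i_1} − g_1, …, t_{i_{e−r}} − g_{e−r}⟩ of E satisfies σ(I) = I (a reflexive difference ideal); a polynomial ring E' := A[s_1,…,s_r] equipped with a ring automorphism σ' extending σ on A such that σ'(s_j) = s_j + γ_j with γ_j ∈ A[s_1,…,s_{j−1}] and const(E',σ') = K; and a ring isomorphism μ : E/I → E' such that μ(a + I) = a for all a ∈ A and μ∘σ̄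 = σ'∘μ, where σ̄ is the ring automorphism of E/I induced by σ. -/
namespace MvPolynomial

/-- The semilinear endomorphism of `A[t₁,…,tₑ]` acting as `σ` on coefficients and sending `tᵢ` to
`tᵢ + βᵢ`. -/
noncomputable def shiftHom {A ι : Type*} [CommRing A] (σ : A →+* A) (β : ι → MvPolynomial ι A) :
    MvPolynomial ι A →+* MvPolynomial ι A :=
  eval₂Hom (C.comp σ) (fun i => X i + β i)

@[simp] theorem shiftHom_C {A ι : Type*} [CommRing A] (σ : A →+* A) (β : ι → MvPolynomial ι A)
    (a : A) : shiftHom σ β (C a) = C (σ a) := by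
  simp [shiftHom]

@[simp] theorem shiftHom_X {A ι : Type*} [CommRing A] (σ : A →+* A) (β : ι → MvPolynomial ι A)
    (i : ι) : shiftHom σ β (X i) = X i + β i := by
  simp [shiftHom]

theorem adjoin_lt_eq_supported {A ι : Type*} [CommRing A] [Preorder ι] (i : ι) :
    Algebra.adjoin A {x | ∃ j, j < i ∧ x = (X j : MvPolynomial ι A)} =
      supported A (Set.Iio i) := by
  unfold supported
  congr 1
  ext x
  simp [eq_comm]

section Bijective

variable {A : Type*} [CommRing A] {e : ℕ}

theorem exists_shiftHom_eq_of_mem_supported (σ : A ≃+* A) (β : Fin e → MvPolynomial (Fin e) A)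
    (hβ : ∀ i, β i ∈ supported A (Set.Iio i)) (i : Fin e) :
    ∀ x ∈ supported A (Set.Iio i), ∃ y ∈ supported A (Set.Iio i),
      shiftHom (σ : A →+* A) β y = x := by
  induction i using WellFoundedLT.induction with
  | ind i ih =>
    intro x hx
    induction hx using Algebra.adjoin_induction with
    | mem x hx =>
      obtain ⟨m, hm, rfl⟩ := hx
      obtain ⟨y, hy, hyx⟩ := ih m hm _ (hβ m)
      refine ⟨X m - y, sub_mem (Algebra.subset_adjoin ⟨m, hm, rfl⟩)
        (supported_mono (Set.Iio_subset_Iio (le_of_lt hm)) hy), ?_⟩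
      simp [hyx]
    | algebraMap a =>
      exact ⟨C (σ.symm a), Subalgebra.algebraMap_mem _ _, by simp [algebraMap_eq]⟩
    | add x y _ _ hx hy =>
      obtain ⟨x', hx', rfl⟩ := hx
      obtain ⟨y', hy', rfl⟩ := hy
      exact ⟨x' + y', add_mem hx' hy', map_add _ _ _⟩
    | mul x y _ _ hx hy =>
      obtain ⟨x', hx', rfl⟩ := hx
      obtain ⟨y', hy', rfl⟩ := hy
      exact ⟨x' * y', mul_mem hx' hy', map_mul _ _ _⟩

theorem exists_shiftHom_comp_eq_id (σ : A ≃+* A) (β : Fin e → MvPolynomial (Fin e) A)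
    (hβ : ∀ i, β i ∈ supported A (Set.Iio i)) :
    ∃ δ : Fin e → MvPolynomial (Fin e) A, (∀ i, δ i ∈ supported A (Set.Iio i)) ∧
      (shiftHom (σ : A →+* A) β).comp (shiftHom (σ.symm : A →+* A) δ) = RingHom.id _ := by
  choose y hy hyx using fun i => exists_shiftHom_eq_of_mem_supported σ β hβ i _ (hβ i)
  refine ⟨fun i => -y i, fun i => neg_mem (hy i), ?_⟩
  ext i
  · simp
  · simp [hyx]

theorem shiftHom_bijective (σ : A ≃+* A) (β : Fin e → MvPolynomial (Fin e) A)
    (hβ : ∀ i, β i ∈ supported A (Set.Iio i)) :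
    Function.Bijective (shiftHom (σ : A →+* A) β) := by
  obtain ⟨δ, hδ, h⟩ := exists_shiftHom_comp_eq_id σ β hβ
  obtain ⟨ε, -, h'⟩ := exists_shiftHom_comp_eq_id σ.symm δ hδ
  have hε : shiftHom (σ.symm.symm : A →+* A) ε = shiftHom (σ : A →+* A) β := by
    rw [← RingHom.comp_id (shiftHom (σ : A →+* A) β), ← h', ← RingHom.comp_assoc, h,
      RingHom.id_comp]
  rw [hε] at h'
  exact Function.bijective_iff_has_inverse.2
    ⟨_, fun x => RingHom.congr_fun h' x, fun x => RingHom.congr_fun h x⟩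

end Bijective

/-- A nonconstant polynomial fixed by the automorphism `t ↦ t + h` produces a solution of the
telescoping equation `τ u = u + h` among the coefficients. -/
theorem _root_.Polynomial.natDegree_eq_zero_of_taylor_map_eq {B : Type*} [CommRing B] [Algebra ℚ B]
    (τ : B →+* B) (hτ : ∀ c, τ c = c → c ≠ 0 → IsUnit c) (h : B) (hh : ¬ ∃ u, τ u = u + h)
    (f : Polynomial B) (hf : Polynomial.taylor h (f.map τ) = f) : f.natDegree = 0 := by
  by_contra hd
  obtain ⟨n, hn⟩ := Nat.exists_eq_succ_of_ne_zero hd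
  have hdeg : (f.map τ).natDegree ≤ n + 1 := Polynomial.natDegree_map_le.trans hn.le
  have h1 : τ (f.coeff (n + 1)) = f.coeff (n + 1) := by
    conv_rhs => rw [← hf]
    rw [Polynomial.taylor_coeff, Polynomial.eq_C_of_natDegree_le_zero
      (p := Polynomial.hasseDeriv (n + 1) (f.map τ))
      ((Polynomial.natDegree_hasseDeriv_le _ _).trans (by omega))]
    simp [Polynomial.hasseDeriv_coeff]
  have h2 : f.coeff n = (n + 1) * f.coeff (n + 1) * h + τ (f.coeff n) := by
    conv_lhs => rw [← hf]
    rw [Polynomial.taylor_coeff, Polynomial.eq_X_add_C_of_natDegree_le_one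
      (p := Polynomial.hasseDeriv n (f.map τ))
      ((Polynomial.natDegree_hasseDeriv_le _ _).trans (by omega))]
    simp [Polynomial.hasseDeriv_coeff, h1, add_comm 1 n]
  have hlead : f.coeff (n + 1) ≠ 0 := by
    intro h0
    have : f = 0 := by rw [← Polynomial.leadingCoeff_eq_zero, Polynomial.leadingCoeff, hn]; exact h0
    simp [this] at hd
  obtain ⟨v, hv⟩ := hτ _ h1 hlead
  have hn1 : ((n : B) + 1) * algebraMap ℚ B ((n : ℚ) + 1)⁻¹ = 1 := by
    have : ((n : B) + 1) = algebraMap ℚ B ((n : ℚ) + 1) := by simp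
    rw [this, ← map_mul, mul_inv_cancel₀ (by positivity), map_one]
  set q := algebraMap ℚ B ((n : ℚ) + 1)⁻¹ with hq
  have hτq : τ q = q := by
    rw [hq, RingHom.map_rat_algebraMap]
  have hτv : τ (↑v⁻¹ : B) = ↑v⁻¹ := by
    have h3 : (v : B) * τ ↑v⁻¹ = 1 := by
      conv_lhs => rw [hv, ← h1, ← hv, ← map_mul, Units.mul_inv, map_one]
    exact Units.eq_inv_of_mul_eq_one_left h3
  rw [← hv] at h2
  refine hh ⟨-(q * ↑v⁻¹ * f.coeff n), ?_⟩
  have h3 : τ (f.coeff n) = f.coeff n - (n + 1) * v * h := by linear_combination -h2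
  simp only [map_neg, map_mul, hτq, hτv, h3]
  linear_combination (h * (v * ↑v⁻¹ : B)) * hn1 + h * v.mul_inv

theorem map_rename_supported {A ι κ : Type*} [CommRing A] (f : ι → κ) (s : Set ι) :
    (supported A s).map (rename f) = supported A (f '' s) := by
  rw [supported, supported, AlgHom.map_adjoin]
  congr 1
  ext x
  simp

theorem rename_castSucc_mem_supported {A : Type*} [CommRing A] {n : ℕ} {i : Fin n}
    {x : MvPolynomial (Fin n) A} (hx : x ∈ supported A (Set.Iio i)) :
    rename Fin.castSucc x ∈ supported A (Set.Iio i.castSucc) := by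
  rw [← Fin.image_castSucc_Iio, ← map_rename_supported]
  exact ⟨x, hx, rfl⟩

theorem exists_rename_castSucc_eq {A : Type*} [CommRing A] {n : ℕ} {i : Fin n}
    {x : MvPolynomial (Fin (n + 1)) A} (hx : x ∈ supported A (Set.Iio i.castSucc)) :
    ∃ y ∈ supported A (Set.Iio i), rename Fin.castSucc y = x := by
  rwa [← Fin.image_castSucc_Iio, ← map_rename_supported] at hx

theorem rename_castSucc_mem_supported_last {A : Type*} [CommRing A] {n : ℕ}
    (x : MvPolynomial (Fin n) A) :
    rename Fin.castSucc x ∈ supported A (Set.Iio (Fin.last n)) := by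
  have : Set.Iio (Fin.last n) = Fin.castSucc '' Set.univ := by
    rw [Set.image_univ, Fin.range_castSucc]; rfl
  rw [this, ← map_rename_supported, supported_univ]
  exact ⟨x, trivial, rfl⟩

theorem exists_rename_castSucc_eq_of_last {A : Type*} [CommRing A] {n : ℕ}
    {x : MvPolynomial (Fin (n + 1)) A} (hx : x ∈ supported A (Set.Iio (Fin.last n))) :
    ∃ y, rename Fin.castSucc y = x := by
  have : Set.Iio (Fin.last n) = Fin.castSucc '' Set.univ := by
    rw [Set.image_univ, Fin.range_castSucc]; rfl
  rw [this, ← map_rename_supported, supported_univ] at hx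
  obtain ⟨y, -, h⟩ := hx
  exact ⟨y, h⟩

theorem shiftHom_rename_castSucc {A : Type*} [CommRing A] {n : ℕ} (σ : A →+* A)
    (γ : Fin n → MvPolynomial (Fin n) A) (γ' : Fin (n + 1) → MvPolynomial (Fin (n + 1)) A)
    (hγ' : ∀ i, γ' (Fin.castSucc i) = rename Fin.castSucc (γ i)) (p : MvPolynomial (Fin n) A) :
    shiftHom σ γ' (rename Fin.castSucc p) = rename Fin.castSucc (shiftHom σ γ p) := by
  induction p using MvPolynomial.induction_on with
  | C a => simp
  | add p q hp hq => simp [hp, hq]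
  | mul_X p i hp => simp [hp, hγ']

theorem shiftHom_snoc_const {A : Type*} [CommRing A] [Algebra ℚ A] {n : ℕ} (σ : A →+* A)
    (hK : ∀ c, σ c = c → c ≠ 0 → IsUnit c) (γ : Fin n → MvPolynomial (Fin n) A)
    (hγ : ∀ f, shiftHom σ γ f = f → ∃ c, σ c = c ∧ f = C c) (h : MvPolynomial (Fin n) A)
    (hh : ¬ ∃ u, shiftHom σ γ u = u + h)
    (γ' : Fin (n + 1) → MvPolynomial (Fin (n + 1)) A)
    (hγ' : ∀ i, γ' (Fin.castSucc i) = rename Fin.castSucc (γ i))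
    (hlast : γ' (Fin.last n) = rename Fin.castSucc h)
    (f : MvPolynomial (Fin (n + 1)) A) (hf : shiftHom σ γ' f = f) :
    ∃ c, σ c = c ∧ f = C c := by
  obtain ⟨Φ, hΦX, hΦlast, hΦC⟩ :
      ∃ Φ : MvPolynomial (Fin (n + 1)) A ≃ₐ[A] Polynomial (MvPolynomial (Fin n) A),
        (∀ i : Fin n, Φ (X i.castSucc) = Polynomial.C (X i)) ∧
        Φ (X (Fin.last n)) = Polynomial.X ∧ ∀ a : A, Φ (C a) = Polynomial.C (C a) :=
    ⟨(renameEquiv A finSuccEquivLast).trans (optionEquivLeft A (Fin n)),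
      fun i => by simp, by simp, fun a => by simp⟩
  have hΦr (p : MvPolynomial (Fin n) A) : Φ (rename Fin.castSucc p) = Polynomial.C p := by
    induction p using MvPolynomial.induction_on with
    | C a => rw [rename_C, hΦC]
    | add p q hp hq => rw [map_add, map_add, hp, hq, map_add]
    | mul_X p i hp => rw [map_mul, map_mul, hp, rename_X, hΦX, map_mul]
  have key (p : MvPolynomial (Fin (n + 1)) A) : Φ (shiftHom σ γ' p) =
      Polynomial.taylor h ((Φ p).map (shiftHom σ γ)) := by
    induction p using MvPolynomial.induction_on with
    | C a => simp [hΦC]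
    | add p q hp hq => simp [hp, hq]
    | mul_X p i hp =>
      rw [map_mul, map_mul, hp, map_mul, Polynomial.map_mul, Polynomial.taylor_mul]
      congr 1
      induction i using Fin.lastCases with
      | last => simp [hlast, hΦlast, hΦr]
      | cast i => simp [hγ', hΦX, hΦr]
  have hdeg := Polynomial.natDegree_eq_zero_of_taylor_map_eq (shiftHom σ γ)
    (fun c hc hc0 => by
      obtain ⟨a, ha, rfl⟩ := hγ c hc
      exact (hK a ha (by rintro rfl; simp at hc0)).map C) h hh (Φ f) (by rw [← key, hf])
  rw [Polynomial.natDegree_eq_zero] at hdeg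
  obtain ⟨p, hp⟩ := hdeg
  have hfp : f = rename Fin.castSucc p := Φ.injective (by rw [hΦr, hp])
  have hpc : shiftHom σ γ p = p := by
    rw [hfp, shiftHom_rename_castSucc σ γ γ' hγ'] at hf
    exact rename_injective _ (Fin.castSucc_injective n) hf
  obtain ⟨c, hc, rfl⟩ := hγ p hpc
  exact ⟨c, hc, by rw [hfp, rename_C]⟩

/-- Every triangular shift on `A[t₁,…,tₑ]` maps onto a triangular shift on `A[s₁,…,sᵣ]` without new
constants, by sending some of the variables to the new variables, and eliminating the others in
terms of earlier ones. -/
theorem exists_shiftHom_quotient {A : Type*} [CommRing A] [Algebra ℚ A] (σ : A →+* A)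
    (hK : ∀ c, σ c = c → c ≠ 0 → IsUnit c) (e : ℕ) (β : Fin e → MvPolynomial (Fin e) A)
    (hβ : ∀ i, β i ∈ supported A (Set.Iio i)) :
    ∃ (r : ℕ) (φ : MvPolynomial (Fin e) A →ₐ[A] MvPolynomial (Fin r) A) (ψ : Fin r → Fin e)
      (g : Fin e → MvPolynomial (Fin e) A) (γ : Fin r → MvPolynomial (Fin r) A),
      (∀ i, g i ∈ supported A (Set.Iio i)) ∧ (∀ j, γ j ∈ supported A (Set.Iio j)) ∧
      (∀ j, φ (X (ψ j)) = X j) ∧ (∀ i ∉ Set.range ψ, φ (X i) = φ (g i)) ∧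
      (∀ x, φ (shiftHom σ β x) = shiftHom σ γ (φ x)) ∧
      (∀ f, shiftHom σ γ f = f → ∃ c, σ c = c ∧ f = C c) := by
  induction e with
  | zero =>
    refine ⟨0, AlgHom.id A _, id, fun _ => 0, 0, fun i => i.elim0, fun i => i.elim0,
      fun i => i.elim0, fun i => i.elim0, fun x => ?_, fun f hf => ?_⟩
    · rw [Subsingleton.elim β 0]; rfl
    · obtain ⟨a, rfl⟩ := C_surjective (Fin 0) f
      exact ⟨a, C_injective (Fin 0) A (by simpa using hf), rfl⟩
  | succ e ih =>
    choose β₀ hβ₀ hβ₀' using fun i : Fin e => exists_rename_castSucc_eq (hβ i.castSucc)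
    obtain ⟨b, hb⟩ := exists_rename_castSucc_eq_of_last (hβ (Fin.last e))
    obtain ⟨r, φ, ψ, g, γ, hg, hγ, hψ, hφg, hφ, hconst⟩ := ih β₀ hβ₀
    by_cases hu : ∃ u, shiftHom σ γ u = u + φ b
    · obtain ⟨u, hu⟩ := hu
      let φ' : MvPolynomial (Fin (e + 1)) A →ₐ[A] MvPolynomial (Fin r) A :=
        aeval (Fin.lastCases u fun i => φ (X i))
      have hφ'X (i : Fin e) : φ' (X i.castSucc) = φ (X i) := by simp [φ']
      have hφ'last : φ' (X (Fin.last e)) = u := by simp [φ']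
      have hφ'r (p : MvPolynomial (Fin e) A) : φ' (rename Fin.castSucc p) = φ p := by
        have : φ'.comp (rename Fin.castSucc) = φ := by ext i; simp [hφ'X]
        exact DFunLike.congr_fun this p
      have hw : φ (rename ψ u) = u := by
        have : φ.comp (rename ψ) = AlgHom.id A _ := by ext i; simp [hψ]
        exact DFunLike.congr_fun this u
      refine ⟨r, φ', fun j => (ψ j).castSucc,
        Fin.lastCases (rename Fin.castSucc (rename ψ u)) fun i => rename Fin.castSucc (g i), γ,
        fun i => ?_, hγ, fun j => by rw [hφ'X, hψ], fun i hi => ?_, fun x => ?_, hconst⟩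
      · induction i using Fin.lastCases with
        | last => simpa using rename_castSucc_mem_supported_last (rename ψ u)
        | cast i => simpa using rename_castSucc_mem_supported (hg i)
      · induction i using Fin.lastCases with
        | last => simp only [Fin.lastCases_last, hφ'last, hφ'r, hw]
        | cast i =>
          simp only [Fin.lastCases_castSucc, hφ'X, hφ'r]
          exact hφg i fun ⟨j, hj⟩ => hi ⟨j, congrArg _ hj⟩
      · induction x using MvPolynomial.induction_on with
        | C a => simp [φ']
        | add p q hp hq => simp only [map_add, hp, hq]
        | mul_X p i hp =>
          simp only [map_mul, hp]
          congr 1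
          induction i using Fin.lastCases with
          | last => rw [shiftHom_X, map_add, hφ'last, ← hb, hφ'r, hu]
          | cast i => rw [shiftHom_X, map_add, hφ'X, ← hβ₀', hφ'r, ← hφ, shiftHom_X, map_add]
    · let φ' : MvPolynomial (Fin (e + 1)) A →ₐ[A] MvPolynomial (Fin (r + 1)) A :=
        aeval (Fin.lastCases (X (Fin.last r)) fun i => rename Fin.castSucc (φ (X i)))
      have hφ'X (i : Fin e) : φ' (X i.castSucc) = rename Fin.castSucc (φ (X i)) := by simp [φ']
      have hφ'last : φ' (X (Fin.last e)) = X (Fin.last r) := by simp [φ']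
      have hφ'r (p : MvPolynomial (Fin e) A) :
          φ' (rename Fin.castSucc p) = rename Fin.castSucc (φ p) := by
        have : φ'.comp (rename Fin.castSucc) = (rename Fin.castSucc).comp φ := by
          ext i; simp [hφ'X]
        exact DFunLike.congr_fun this p
      let γ' : Fin (r + 1) → MvPolynomial (Fin (r + 1)) A :=
        Fin.lastCases (rename Fin.castSucc (φ b)) fun i => rename Fin.castSucc (γ i)
      have hγ'X (i : Fin r) : γ' i.castSucc = rename Fin.castSucc (γ i) := by simp [γ']
      have hγ'last : γ' (Fin.last r) = rename Fin.castSucc (φ b) := by simp [γ']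
      refine ⟨r + 1, φ', Fin.lastCases (Fin.last e) fun j => (ψ j).castSucc,
        Fin.lastCases 0 fun i => rename Fin.castSucc (g i), γ',
        fun i => ?_, fun i => ?_, fun j => ?_, fun i hi => ?_, fun x => ?_,
        shiftHom_snoc_const σ hK γ hconst (φ b) hu γ' hγ'X hγ'last⟩
      · induction i using Fin.lastCases with
        | last => simp
        | cast i => simpa using rename_castSucc_mem_supported (hg i)
      · induction i using Fin.lastCases with
        | last => rw [hγ'last]; exact rename_castSucc_mem_supported_last _
        | cast i => rw [hγ'X]; exact rename_castSucc_mem_supported (hγ i)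
      · induction j using Fin.lastCases with
        | last => simp only [Fin.lastCases_last, hφ'last]
        | cast i => simp only [Fin.lastCases_castSucc, hφ'X, hψ, rename_X]
      · induction i using Fin.lastCases with
        | last => exact absurd ⟨Fin.last r, Fin.lastCases_last ..⟩ hi
        | cast i =>
          simp only [Fin.lastCases_castSucc, hφ'X, hφ'r]
          exact congrArg _ <| hφg i fun ⟨j, hj⟩ => hi ⟨j.castSucc, by
            simp only [Fin.lastCases_castSucc, hj]⟩
      · induction x using MvPolynomial.induction_on with
        | C a => simp [φ']
        | add p q hp hq => simp only [map_add, hp, hq]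
        | mul_X p i hp =>
          simp only [map_mul, hp]
          congr 1
          induction i using Fin.lastCases with
          | last => rw [shiftHom_X, map_add, hφ'last, ← hb, hφ'r, shiftHom_X, hγ'last]
          | cast i =>
            rw [shiftHom_X, map_add, hφ'X, ← hβ₀', hφ'r,
              shiftHom_rename_castSucc σ γ γ' hγ'X, ← hφ, shiftHom_X, map_add, map_add]

theorem ker_eq_span_X_sub {A : Type*} [CommRing A] {e r : ℕ}
    (φ : MvPolynomial (Fin e) A →ₐ[A] MvPolynomial (Fin r) A) (ψ : Fin r → Fin e)
    (g : Fin e → MvPolynomial (Fin e) A) (hg : ∀ i, g i ∈ supported A (Set.Iio i))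
    (hψ : ∀ j, φ (X (ψ j)) = X j) (hφg : ∀ i ∉ Set.range ψ, φ (X i) = φ (g i)) :
    RingHom.ker φ = Ideal.span ((fun i => X i - g i) '' (Set.range ψ)ᶜ) := by
  set J := Ideal.span ((fun i => X i - g i) '' (Set.range ψ)ᶜ) with hJ
  apply le_antisymm
  · let π : MvPolynomial (Fin e) A →ₐ[A] MvPolynomial (Fin e) A ⧸ J := Ideal.Quotient.mkₐ A J
    have hπX (i : Fin e) : π (rename ψ (φ (X i))) = π (X i) := by
      induction i using WellFoundedLT.induction with
      | ind i ih =>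
        by_cases hi : i ∈ Set.range ψ
        · obtain ⟨j, rfl⟩ := hi
          rw [hψ, rename_X]
        · have hgi : π (rename ψ (φ (g i))) = π (g i) := by
            have hle : supported A (Set.Iio i) ≤
                AlgHom.equalizer ((π.comp (rename ψ)).comp φ) π := by
              refine Algebra.adjoin_le ?_
              rintro _ ⟨m, hm, rfl⟩
              exact ih m hm
            exact hle (hg i)
          rw [hφg i hi, hgi]
          have hmem : X i - g i ∈ J := Ideal.subset_span ⟨i, hi, rfl⟩
          exact (Ideal.Quotient.eq.2 hmem).symm
    have hπ : (π.comp (rename ψ)).comp φ = π := by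
      ext i; exact hπX i
    intro x hx
    rw [← Ideal.Quotient.eq_zero_iff_mem]
    have := DFunLike.congr_fun hπ x
    rw [AlgHom.comp_apply, (RingHom.mem_ker).1 hx, map_zero] at this
    exact this.symm
  · rw [hJ, Ideal.span_le]
    rintro _ ⟨i, hi, rfl⟩
    simp [RingHom.mem_ker, hφg i hi]

end MvPolynomial

open MvPolynomial in
/-- Construction of a maximal reflexive difference ideal in a tower of
S-extensions `E = A[t_1,…,t_e]` (with `σ(t_i) = t_i + β_i`, `β_i` depending only on
earlier variables) over a difference ring `(A,σ)` whose constants form a field, together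
with a ΣΣ*-extension `E' = A[s_1,…,s_r]` and a difference ring isomorphism
`μ : E/I → E'` fixing `A`. -/
theorem stmt11 {A : Type*} [CommRing A] [Algebra ℚ A] [Nontrivial A]
    (σ : A ≃+* A)
    (hK : ∀ c : A, σ c = c → c ≠ 0 → IsUnit c)
    (e : ℕ)
    (σE : MvPolynomial (Fin e) A ≃+* MvPolynomial (Fin e) A)
    (hEC : ∀ a : A, σE (MvPolynomial.C a) = MvPolynomial.C (σ a))
    (β : Fin e → MvPolynomial (Fin e) A)
    (hβ : ∀ i, β i ∈ Algebra.adjoin A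
        {x | ∃ j, j < i ∧ x = (MvPolynomial.X j : MvPolynomial (Fin e) A)})
    (hEX : ∀ i, σE (MvPolynomial.X i) = MvPolynomial.X i + β i) :
    ∃ (r : ℕ) (_ : r ≤ e)
      (idx : Fin (e - r) → Fin e) (_ : StrictMono idx)
      (g : Fin (e - r) → MvPolynomial (Fin e) A)
      (_ : ∀ j, g j ∈ Algebra.adjoin A
        {x | ∃ m, m < idx j ∧ x = (MvPolynomial.X m : MvPolynomial (Fin e) A)})
      (I : Ideal (MvPolynomial (Fin e) A))
      (_ : I = Ideal.span (Set.range fun j => MvPolynomial.X (idx j) - g j))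
      (_ : ∀ x ∈ I, σE x ∈ I) (_ : ∀ x ∈ I, σE.symm x ∈ I)
      (σ' : MvPolynomial (Fin r) A ≃+* MvPolynomial (Fin r) A)
      (γ : Fin r → MvPolynomial (Fin r) A),
      (∀ a : A, σ' (MvPolynomial.C a) = MvPolynomial.C (σ a)) ∧
      (∀ j, γ j ∈ Algebra.adjoin A
        {x | ∃ m, m < j ∧ x = (MvPolynomial.X m : MvPolynomial (Fin r) A)}) ∧
      (∀ j, σ' (MvPolynomial.X j) = MvPolynomial.X j + γ j) ∧
      (∀ f : MvPolynomial (Fin r) A, σ' f = f →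
        ∃ c : A, σ c = c ∧ f = MvPolynomial.C c) ∧
      ∃ μ : (MvPolynomial (Fin e) A ⧸ I) ≃+* MvPolynomial (Fin r) A,
        (∀ a : A, μ (Ideal.Quotient.mk I (MvPolynomial.C a)) = MvPolynomial.C a) ∧
        (∀ x : MvPolynomial (Fin e) A,
          μ (Ideal.Quotient.mk I (σE x)) = σ' (μ (Ideal.Quotient.mk I x))) := by
  obtain ⟨r, φ, ψ, g, γ, hg, hγ, hψ, hφg, hφ, hconst⟩ :=
    exists_shiftHom_quotient (σ : A →+* A) hK e β fun i => adjoin_lt_eq_supported (A := A) i ▸ hβ i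
  have hσE (x : MvPolynomial (Fin e) A) : σE x = shiftHom (σ : A →+* A) β x := by
    have : (σE : MvPolynomial (Fin e) A →+* MvPolynomial (Fin e) A) = shiftHom (σ : A →+* A) β := by
      ext i
      · simp [hEC]
      · simp [hEX]
    exact RingHom.congr_fun this x
  have hinj : Function.Injective ψ := fun i j hij =>
    X_injective (R := A) (by rw [← hψ, hij, hψ])
  have hcard : (Finset.univ.image ψ)ᶜ.card = e - r := by
    rw [Finset.card_compl, Finset.card_image_of_injective _ hinj]
    simp
  have hr : r ≤ e := by simpa using Fintype.card_le_of_injective ψ hinj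
  set idx := (Finset.univ.image ψ)ᶜ.orderEmbOfFin hcard with hidx
  have hrange : Set.range idx = (Set.range ψ)ᶜ := by
    rw [hidx, Finset.range_orderEmbOfFin]
    simp
  have hsurj : Function.Surjective (φ : MvPolynomial (Fin e) A →+* MvPolynomial (Fin r) A) := by
    have : φ.comp (rename ψ) = AlgHom.id A _ := by ext i; simp [hψ]
    exact fun x => ⟨rename ψ x, DFunLike.congr_fun this x⟩
  have hbij := shiftHom_bijective σ γ hγ
  have hφE (x : MvPolynomial (Fin e) A) : φ (σE x) = shiftHom (σ : A →+* A) γ (φ x) := by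
    rw [hσE, hφ]
  have hker : RingHom.ker (φ : MvPolynomial (Fin e) A →+* MvPolynomial (Fin r) A) =
      Ideal.span (Set.range fun j => X (idx j) - g (idx j)) := by
    refine (ker_eq_span_X_sub φ ψ g hg hψ hφg).trans ?_
    rw [← hrange, ← Set.range_comp]
    rfl
  have hmem (x : MvPolynomial (Fin e) A) :
      x ∈ RingHom.ker (φ : MvPolynomial (Fin e) A →+* MvPolynomial (Fin r) A) ↔ φ x = 0 := Iff.rfl
  refine ⟨r, hr, idx, idx.strictMono, fun j => g (idx j), fun j => ?_,
    RingHom.ker (φ : MvPolynomial (Fin e) A →+* MvPolynomial (Fin r) A), hker,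
    fun x hx => ?_, fun x hx => ?_, RingEquiv.ofBijective _ hbij, γ, shiftHom_C _ _, fun j => ?_,
    shiftHom_X _ _, hconst, RingHom.quotientKerEquivOfSurjective hsurj, φ.commutes, hφE⟩
  · rw [adjoin_lt_eq_supported]
    exact hg _
  · rw [hmem] at hx ⊢
    rw [hφE, hx, map_zero]
  · rw [hmem] at hx ⊢
    apply hbij.injective
    rw [← hφE, σE.apply_symm_apply, hx, map_zero]
  · rw [adjoin_lt_eq_supported]
    exact hγ j
end

section
/- Let (A,σ) be a difference ring whose ring of constants K := const(A,σ) is a field, and let f_1,…,f_d ∈ A. Let E := A[t_1,…,t_d] be the polynomial ring in d variables over A, equipped with the unique ring automorphism extending σ (acting on coefficients) such that σ(t_i) = t_i + f_i for all i. Then the following are equivalent: (1) there exist no g ∈ A and (c_1,…,c_d) ∈ K^d with (c_1,…,c_d) ≠ (0,…,0) such that σ(g) − g = c_1·f_1 + ⋯ + c_d·f_d; (2) const(E,σ) = const(A,σ), i.e., every f ∈ E with σ(f) = f is a constant polynomial with coefficient in K. -/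
namespace MvPolynomial

/-- A polynomial over a `ℚ`-algebra all of whose partial derivatives vanish is constant. -/
theorem eq_C_of_pderiv_eq_zero {ι R : Type*} [CommRing R] [Algebra ℚ R]
    {p : MvPolynomial ι R} (hp : ∀ i, pderiv i p = 0) : p = C (coeff 0 p) := by
  classical
  ext m
  rw [coeff_C]
  split_ifs with hm
  · rw [hm]
  · obtain ⟨i, hi⟩ : ∃ i, m i ≠ 0 := by
      by_contra! h
      exact hm (Finsupp.ext fun i => (h i).symm)
    have hle : Finsupp.single i 1 ≤ m := by
      rw [Finsupp.single_le_iff]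
      exact Nat.one_le_iff_ne_zero.mpr hi
    have h := coeff_pderiv (i := i) p (m - Finsupp.single i 1)
    rw [hp i, coeff_zero, tsub_add_cancel_of_le hle] at h
    have hu : IsUnit (((m - Finsupp.single i 1 : ι →₀ ℕ) i : R) + 1) := by
      have h := (IsUnit.mk0 (((m - Finsupp.single i 1 : ι →₀ ℕ) i : ℚ) + 1)
        (Nat.cast_add_one_ne_zero _)).map (algebraMap ℚ R)
      rwa [map_add, map_natCast, map_one] at h
    exact hu.mul_left_eq_zero.mp h.symm

/-- Partial derivatives commute with a semilinear translation of the variables. -/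
theorem pderiv_translation {ι R : Type*} [CommRing R] (σ : R ≃+* R) (f : ι → R)
    (τ : MvPolynomial ι R ≃+* MvPolynomial ι R)
    (hC : ∀ a : R, τ (C a) = C (σ a)) (hX : ∀ i, τ (X i) = X i + C (f i))
    (i : ι) (p : MvPolynomial ι R) : pderiv i (τ p) = τ (pderiv i p) := by
  classical
  induction p using MvPolynomial.induction_on with
  | C a => simp [hC]
  | add p q hp hq => simp [hp, hq]
  | mul_X p j hp =>
    have hj : pderiv i (X j + C (f j)) = τ (pderiv i (X j)) := by
      rw [map_add, pderiv_C, add_zero, pderiv_X]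
      by_cases hij : j = i
      · subst hij
        simp
      · simp [hij]
    rw [map_mul, pderiv_mul, pderiv_mul, map_add, map_mul, map_mul, hp, hX, hj]

/-- If `∑ i, c i * f i = σ g - g` with invariant `c i` only holds for `c = 0`, then every polynomial
invariant under the semilinear translation by `f` is constant. -/
theorem exists_eq_C_of_translation_invariant {ι R : Type*} [Fintype ι] [CommRing R] [Algebra ℚ R]
    (σ : R ≃+* R) (f : ι → R) (τ : MvPolynomial ι R ≃+* MvPolynomial ι R)
    (hC : ∀ a : R, τ (C a) = C (σ a)) (hX : ∀ i, τ (X i) = X i + C (f i))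
    (hf : ∀ (g : R) (c : ι → R), (∀ i, σ (c i) = c i) → σ g - g = ∑ i, c i * f i → ∀ i, c i = 0)
    {p : MvPolynomial ι R} (hp : τ p = p) : ∃ c : R, σ c = c ∧ p = C c := by
  classical
  suffices H : ∀ (n : ℕ) (p : MvPolynomial ι R), (∀ m : ι →₀ ℕ, n ≤ m.degree → coeff m p = 0) →
      τ p = p → ∃ c : R, σ c = c ∧ p = C c by
    refine H (p.totalDegree + 1) p (fun m hm => coeff_eq_zero_of_totalDegree_lt ?_) hp
    rw [← Finsupp.degree_apply]
    exact hm
  intro n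
  induction n with
  | zero =>
    intro p hn _
    refine ⟨0, map_zero σ, ?_⟩
    rw [C_0]
    ext m
    simpa using hn m (Nat.zero_le _)
  | succ n ih =>
    intro p hn hp
    have hd : ∀ i, ∃ c : R, σ c = c ∧ pderiv i p = C c := by
      intro i
      refine ih _ (fun m hm => ?_) ?_
      · rw [coeff_pderiv, hn, zero_mul]
        rw [map_add, Finsupp.degree_single]
        exact Nat.succ_le_succ hm
      · rw [← pderiv_translation σ f τ hC hX, hp]
    choose c hc hpc using hd
    have hlin := eq_C_of_pderiv_eq_zero (p := p - ∑ i, C (c i) * X i) (fun i => by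
      simp [hpc, pderiv_X, Pi.single_apply])
    set b := coeff 0 (p - ∑ i, C (c i) * X i)
    have hpb : p = ∑ i, C (c i) * X i + C b := by rw [← hlin]; ring
    have hrel : ∑ i, c i * f i + σ b - b = 0 := by
      have h := hp
      rw [hpb] at h
      simp only [map_add, map_sum, map_mul, hC, hX, hc, mul_add, Finset.sum_add_distrib] at h
      apply C_injective ι R
      simp only [map_add, map_sub, map_sum, map_mul, map_zero]
      linear_combination h
    have hc0 := hf (-b) c hc (by rw [map_neg]; linear_combination -hrel)
    refine ⟨b, ?_, ?_⟩
    · simp only [hc0, zero_mul, Finset.sum_const_zero, zero_add] at hrel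
      exact sub_eq_zero.mp hrel
    · simpa [hc0] using hpb

end MvPolynomial


/-- Let `(A,σ)` be a difference ring whose ring of constants `K` is a
field, `f_1,…,f_d ∈ A`, and `E = A[t_1,…,t_d]` with `σ(t_i) = t_i + f_i`. Then there is
no `g ∈ A` and `0 ≠ (c_1,…,c_d) ∈ K^d` with `σ(g) − g = c_1 f_1 + ⋯ + c_d f_d` iff
`const(E,σ) = const(A,σ)`. -/
theorem stmt19 {A : Type*} [CommRing A] [Algebra ℚ A] [Nontrivial A]
    (σ : A ≃+* A)
    (hK : ∀ c : A, σ c = c → c ≠ 0 → IsUnit c)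
    (d : ℕ) (f : Fin d → A)
    (σE : MvPolynomial (Fin d) A ≃+* MvPolynomial (Fin d) A)
    (hEC : ∀ a : A, σE (MvPolynomial.C a) = MvPolynomial.C (σ a))
    (hEX : ∀ i, σE (MvPolynomial.X i) = MvPolynomial.X i + MvPolynomial.C (f i)) :
    (¬ ∃ (g : A) (c : Fin d → A), (∀ i, σ (c i) = c i) ∧ (∃ i, c i ≠ 0) ∧
        σ g - g = ∑ i, c i * f i) ↔
      (∀ h : MvPolynomial (Fin d) A, σE h = h →
        ∃ c : A, σ c = c ∧ h = MvPolynomial.C c) := by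
  constructor
  · intro hf h hh
    refine MvPolynomial.exists_eq_C_of_translation_invariant σ f σE hEC hEX ?_ hh
    intro g c hc hg
    by_contra! hne
    exact hf ⟨g, c, hc, hne, hg⟩
  · rintro H ⟨g, c, hc, ⟨i, hi⟩, hg⟩
    obtain ⟨b, -, hb⟩ := H (∑ j, MvPolynomial.C (c j) * MvPolynomial.X j - MvPolynomial.C g) (by
      have h := congrArg (MvPolynomial.C (σ := Fin d)) hg
      simp only [map_sub, map_sum, map_mul] at h
      simp only [map_sub, map_sum, map_mul, hEC, hEX, hc, mul_add, Finset.sum_add_distrib]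
      linear_combination -h)
    have hder := congrArg (MvPolynomial.pderiv i) hb
    exact hi (by simpa [MvPolynomial.pderiv_X, Pi.single_apply] using hder)
end
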